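/- Focusing case on the line, existence and shape of ground states: let p ∈ (2,6), α > 0 and μ ∈ (0, μ_ℝ). Then the infimum ℰ_α(μ, ℝ) is achieved: there exists u ∈ H¹_μ(ℝ) with E_α(u) = ℰ_α(μ, ℝ) such that u is strictly positive, even (u(−x) = u(x) for all x), and nonincreasing on [0, +∞). -/

import Mathlib

open MeasureTheory Real Set Filter

/-- Membership in `H¹(ℝ)`: `u` is differentiable with derivative `u'`,
and both `u` and `u'` are square-integrable on `ℝ`. -/
def H1line (u u' : ℝ → ℝ) : Prop :=
  (∀ x, HasDerivAt u (u' x) x) ∧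
  Integrable (fun x => (u x) ^ 2) ∧
  Integrable (fun x => (u' x) ^ 2)

/-- The NLS energy with combined nonlinearities
`E_α(u) = ∫_ℝ (½|u'|² − (1/6)|u|⁶ − (α/p)|u|^p)`. -/
noncomputable def Eline (p α : ℝ) (u u' : ℝ → ℝ) : ℝ :=
  ∫ x, (1 / 2 * (u' x) ^ 2 - 1 / 6 * |u x| ^ 6 - α / p * |u x| ^ p)

/-- The ground state energy level `ℰ_α(μ, ℝ) = inf {E_α(u) : u ∈ H¹_μ(ℝ)}`. -/
noncomputable def glevelLine (p α μ : ℝ) : ℝ :=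
  sInf {e : ℝ | ∃ u u' : ℝ → ℝ, H1line u u' ∧ (∫ x, (u x) ^ 2) = μ ∧ Eline p α u u' = e}

/-- The nonlinear potential of the stationary equation on the line: solitons of height `M` satisfy
`u'² = u² (pot c q M - pot c q u)`. -/
noncomputable def pot (c q t : ℝ) : ℝ := t ^ 4 / 3 + c * |t| ^ q

lemma pot_zero (c : ℝ) {q : ℝ} (hq : 0 < q) : pot c q 0 = 0 := by
  simp [pot, Real.zero_rpow hq.ne']

lemma pot_abs (c q t : ℝ) : pot c q |t| = pot c q t := by
  have h : |t| ^ 4 = t ^ 4 := by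
    rw [show (4 : ℕ) = 2 * 2 from rfl, pow_mul, sq_abs, ← pow_mul]
  simp [pot, h]

lemma continuous_pot (c : ℝ) {q : ℝ} (hq : 0 < q) : Continuous (pot c q) := by
  unfold pot
  have : Continuous fun t : ℝ => |t| ^ q := continuous_abs.rpow_const fun _ => Or.inr hq.le
  fun_prop

/-- The derivative of `pot c q` on the positive half-line. -/
noncomputable def pot' (c q t : ℝ) : ℝ := 4 * t ^ 3 / 3 + c * (q * t ^ (q - 1))

lemma hasDerivAt_pot (c q : ℝ) {t : ℝ} (ht : 0 < t) :
    HasDerivAt (pot c q) (pot' c q t) t := by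
  have h1 : HasDerivAt (fun x : ℝ => x ^ 4 / 3 + c * x ^ q) (pot' c q t) t := by
    have h2 := (hasDerivAt_pow 4 t).div_const 3
    have h3 := (Real.hasDerivAt_rpow_const (p := q) (Or.inl ht.ne')).const_mul c
    refine (h2.add h3).congr_deriv ?_
    simp [pot']
  refine h1.congr_of_eventuallyEq ?_
  filter_upwards [lt_mem_nhds ht] with x hx
  simp [pot, abs_of_pos hx]

lemma pot_sub_ge {c q : ℝ} (hc : 0 < c) (hq : 0 < q) {s t : ℝ} (hs : 0 ≤ s) (hst : s ≤ t) :
    (t ^ 4 - s ^ 4) / 3 ≤ pot c q t - pot c q s := by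
  have : s ^ q ≤ t ^ q := Real.rpow_le_rpow hs hst hq.le
  simp only [pot, abs_of_nonneg hs, abs_of_nonneg (hs.trans hst)]
  nlinarith [mul_le_mul_of_nonneg_left this hc.le]

lemma pot_strictMonoOn {c q : ℝ} (hc : 0 < c) (hq : 0 < q) :
    StrictMonoOn (pot c q) (Ici 0) := by
  intro s hs t _ hst
  have h1 := pot_sub_ge hc hq (mem_Ici.1 hs) hst.le
  have h2 : s ^ 4 < t ^ 4 := pow_lt_pow_left₀ hst hs (by norm_num)
  linarith

lemma pot_nonneg {c q : ℝ} (hc : 0 < c) (t : ℝ) : 0 ≤ pot c q t := by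
  unfold pot; positivity

lemma pot'_pos {c q : ℝ} (hc : 0 < c) (hq : 0 < q) {t : ℝ} (ht : 0 < t) : 0 < pot' c q t := by
  unfold pot'; positivity

lemma measurable_pot' (c q : ℝ) : Measurable (pot' c q) := by
  unfold pot'; fun_prop

/-- The autonomous equation `z' = F z` with `F` vanishing at `0` has an increasing solution leaving
the origin as soon as `1 / F` is integrable near `0`. -/
lemma exists_increasing_solution {F : ℝ → ℝ} {B : ℝ} (hF : Continuous F)
    (hpos : ∀ ζ, 0 < ζ → 0 < F ζ) (hB : ∀ ζ, F ζ ≤ B)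
    (hint : ∀ b, 0 ≤ b → IntervalIntegrable (fun ζ => (F ζ)⁻¹) volume 0 b) :
    ∃ z : ℝ → ℝ, StrictMono z ∧ Continuous z ∧ z 0 = 0 ∧ Tendsto z atTop atTop ∧
      ∀ x, 0 < x → HasDerivAt z (F (z x)) x := by
  classical
  set κ : ℝ → ℝ := fun ζ => if ζ ≤ 0 then 1 else (F ζ)⁻¹ with hκ
  have hBpos : 0 < B := (hpos 1 one_pos).trans_le (hB 1)
  have hi0 : ∀ b, IntervalIntegrable κ volume 0 b := by
    intro b
    rcases le_total 0 b with hb | hb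
    · refine (hint b hb).congr ?_
      intro x hx
      rw [uIoc_of_le hb] at hx
      simp [hκ, not_le.2 hx.1]
    · refine (intervalIntegrable_const (c := (1 : ℝ))).congr ?_
      intro x hx
      rw [uIoc_of_ge hb] at hx
      simp [hκ, hx.2]
  have hi : ∀ a b, IntervalIntegrable κ volume a b := fun a b => (hi0 a).symm.trans (hi0 b)
  obtain ⟨m, hm, hmκ⟩ : ∃ m : ℝ, 0 < m ∧ ∀ ζ, m ≤ κ ζ := by
    refine ⟨min 1 B⁻¹, by positivity, fun ζ => ?_⟩
    by_cases h : ζ ≤ 0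
    · simp [hκ, h]
    · simp only [hκ, h, if_false]
      exact (min_le_right _ _).trans (inv_anti₀ (hpos ζ (not_le.1 h)) (hB ζ))
  set Z : ℝ → ℝ := fun b => ∫ x in (0 : ℝ)..b, κ x with hZ
  have hdiff : ∀ a b, a ≤ b → m * (b - a) ≤ Z b - Z a := by
    intro a b hab
    rw [hZ, intervalIntegral.integral_interval_sub_left (hi0 b) (hi0 a)]
    have := intervalIntegral.integral_mono_on hab intervalIntegrable_const (hi a b)
      (fun x _ => hmκ x)
    simpa [mul_comm] using this
  have hZ0 : Z 0 = 0 := by simp [hZ]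
  have hmono : StrictMono Z := by
    intro a b hab
    have := hdiff a b hab.le
    nlinarith [mul_pos hm (sub_pos.2 hab)]
  have hcont : Continuous Z := intervalIntegral.continuous_primitive hi 0
  have htop : Tendsto Z atTop atTop := by
    refine tendsto_atTop_mono' _ ?_ (tendsto_id.const_mul_atTop hm)
    filter_upwards [eventually_ge_atTop 0] with b hb
    simpa [hZ0] using hdiff 0 b hb
  have hbot : Tendsto Z atBot atBot := by
    refine tendsto_atBot_mono' _ ?_ (tendsto_id.const_mul_atBot hm)
    filter_upwards [eventually_le_atBot 0] with b hb
    have := hdiff b 0 hb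
    simp only [id]
    linarith
  let e := hmono.orderIsoOfSurjective Z (hcont.surjective htop hbot)
  have he : ∀ x, Z (e.symm x) = x := fun x => e.apply_symm_apply x
  have hz0 : e.symm 0 = 0 := by
    apply hmono.injective
    rw [he, hZ0]
  refine ⟨e.symm, e.symm.strictMono, e.symm.continuous, hz0, e.symm.tendsto_atTop, ?_⟩
  intro x hx
  have hzx : 0 < e.symm x := by
    rw [← hz0]; exact e.symm.strictMono hx
  have hev : κ =ᶠ[nhds (e.symm x)] fun ζ => (F ζ)⁻¹ := by
    filter_upwards [lt_mem_nhds hzx] with ζ h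
    simp [hκ, not_le.2 h]
  have hcκ : ContinuousAt κ (e.symm x) :=
    (hF.continuousAt.inv₀ (hpos _ hzx).ne').congr hev.symm
  have hsm : StronglyMeasurableAtFilter κ (nhds (e.symm x)) volume :=
    ⟨univ, univ_mem, by
      refine Measurable.aestronglyMeasurable ?_
      exact Measurable.ite measurableSet_Iic measurable_const hF.measurable.inv⟩
  have hd := intervalIntegral.integral_hasDerivAt_right (hi0 (e.symm x)) hsm hcκ
  rw [hev.eq_of_nhds] at hd
  have := HasDerivAt.of_local_left_inverse e.symm.continuous.continuousAt hd
    (inv_ne_zero (hpos _ hzx).ne') (Eventually.of_forall he)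
  simpa using this
/-- Existence of the positive even soliton of height `M`. -/
lemma exists_soliton {c q M : ℝ} (hc : 0 < c) (hq : 0 < q) (hM : 0 < M) :
    ∃ u u' : ℝ → ℝ, u 0 = M ∧ (∀ x, 0 < u x) ∧ (∀ x, u (-x) = u x) ∧ AntitoneOn u (Ici 0) ∧
      (∀ x, 0 < x → u x < M) ∧ Tendsto u atTop (nhds 0) ∧ (∀ x, HasDerivAt u (u' x) x) ∧
      (∀ x, 0 < x → u' x = -(u x * √(pot c q M - pot c q (u x)))) ∧
      ∀ x, u' x ^ 2 = u x ^ 2 * (pot c q M - pot c q (u x)) := by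
  set F : ℝ → ℝ := fun ζ => √(pot c q M - pot c q (M * exp (-ζ))) with hFdef
  have hpc := continuous_pot c hq
  have hF : Continuous F := by fun_prop
  have hle : ∀ ζ, 0 < ζ → M * exp (-ζ) < M := by
    intro ζ hζ
    have : exp (-ζ) < 1 := Real.exp_lt_one_iff.2 (by linarith)
    nlinarith
  have hpos : ∀ ζ, 0 < ζ → 0 < F ζ := by
    intro ζ hζ
    apply Real.sqrt_pos.2
    have := pot_strictMonoOn hc hq (a := M * exp (-ζ)) (b := M) (mem_Ici.2 (by positivity))
      (mem_Ici.2 hM.le) (hle ζ hζ)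
    linarith
  have hB : ∀ ζ, F ζ ≤ √(pot c q M) := by
    intro ζ
    apply Real.sqrt_le_sqrt
    have := pot_nonneg (q := q) hc (M * exp (-ζ))
    linarith
  have hint : ∀ b, 0 ≤ b → IntervalIntegrable (fun ζ => (F ζ)⁻¹) volume 0 b := by
    intro b hb
    have hdom : IntervalIntegrable (fun ζ : ℝ => √((1 + 4 * b) * (3 / (4 * M ^ 4))) * ζ ^ (-(1 / 2) : ℝ))
        volume 0 b :=
      (intervalIntegral.intervalIntegrable_rpow' (by norm_num)).const_mul _
    refine hdom.mono_fun hF.measurable.inv.aestronglyMeasurable ?_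
    rw [uIoc_of_le hb]
    filter_upwards [ae_restrict_mem measurableSet_Ioc] with ζ hζ
    have hζ0 := hζ.1
    have hFp := hpos ζ hζ0
    rw [Real.norm_of_nonneg (inv_nonneg.2 hFp.le), Real.norm_of_nonneg (by positivity),
      Real.rpow_neg hζ0.le, ← Real.sqrt_eq_rpow, ← Real.sqrt_inv, ← Real.sqrt_inv,
      ← Real.sqrt_mul (by positivity)]
    apply Real.sqrt_le_sqrt
    have h1 := pot_sub_ge hc hq (s := M * exp (-ζ)) (t := M) (by positivity) (hle ζ hζ0).le
    have h2 : (M * exp (-ζ)) ^ 4 = M ^ 4 * exp (-(4 * ζ)) := by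
      rw [mul_pow, ← Real.exp_nat_mul]; congr 2; push_cast; ring
    have h3 : exp (-(4 * ζ)) ≤ (1 + 4 * ζ)⁻¹ := by
      rw [Real.exp_neg]
      exact inv_anti₀ (by positivity) (by linarith [Real.add_one_le_exp (4 * ζ)])
    have h4 : (1 + 4 * b)⁻¹ * (4 * ζ) ≤ 1 - (1 + 4 * ζ)⁻¹ := by
      have : 1 - (1 + 4 * ζ)⁻¹ = (1 + 4 * ζ)⁻¹ * (4 * ζ) := by field_simp; ring
      rw [this]
      have : (1 + 4 * b)⁻¹ ≤ (1 + 4 * ζ)⁻¹ := inv_anti₀ (by positivity) (by linarith [hζ.2])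
      exact mul_le_mul_of_nonneg_right this (by positivity)
    have h5 : ((1 + 4 * b) * (3 / (4 * M ^ 4)) * ζ⁻¹)⁻¹ ≤ pot c q M - pot c q (M * exp (-ζ)) := by
      calc _ = M ^ 4 * ((1 + 4 * b)⁻¹ * (4 * ζ)) / 3 := by field_simp
        _ ≤ M ^ 4 * (1 - exp (-(4 * ζ))) / 3 := by
          have : (1 + 4 * b)⁻¹ * (4 * ζ) ≤ 1 - exp (-(4 * ζ)) := by linarith
          have := mul_le_mul_of_nonneg_left this (by positivity : 0 ≤ M ^ 4)
          linarith
        _ = (M ^ 4 - (M * exp (-ζ)) ^ 4) / 3 := by rw [h2]; ring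
        _ ≤ _ := h1
    have hp : 0 < ((1 + 4 * b) * (3 / (4 * M ^ 4)) * ζ⁻¹)⁻¹ := by positivity
    simpa using inv_anti₀ hp h5
  obtain ⟨z, hzm, hzc, hz0, hztop, hzd⟩ := exists_increasing_solution hF hpos hB hint
  set u : ℝ → ℝ := fun x => M * exp (-z |x|) with hu
  set u' : ℝ → ℝ := fun x => -Real.sign x * (u x * √(pot c q M - pot c q (u x))) with hu'
  have huc : Continuous u := by fun_prop
  have hu0 : u 0 = M := by simp [hu, hz0]
  have hupos : ∀ x, 0 < u x := fun x => by positivity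
  have heven : ∀ x, u (-x) = u x := fun x => by simp [hu]
  have hanti : AntitoneOn u (Ici 0) := by
    intro x hx y hy hxy
    simp only [hu, abs_of_nonneg (mem_Ici.1 hx), abs_of_nonneg (mem_Ici.1 hy)]
    have := hzm.monotone hxy
    gcongr
  have hlt : ∀ x, 0 < x → u x < M := by
    intro x hx
    simp only [hu, abs_of_pos hx]
    exact hle _ (by rw [← hz0]; exact hzm hx)
  have hleM : ∀ x, u x ≤ M := by
    intro x
    rcases lt_trichotomy x 0 with h | h | h
    · rw [← heven]; exact (hlt _ (by linarith)).le
    · rw [h, hu0]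
    · exact (hlt _ h).le
  have hdpos : ∀ x, 0 < x → HasDerivAt u (u' x) x := by
    intro x hx
    have h1 : HasDerivAt (fun y => M * exp (-z y)) (M * (exp (-z x) * -F (z x))) x :=
      ((hzd x hx).neg.exp).const_mul M
    have h2 : u =ᶠ[nhds x] fun y => M * exp (-z y) := by
      filter_upwards [lt_mem_nhds hx] with y hy
      simp [hu, abs_of_pos hy]
    refine (h1.congr_of_eventuallyEq h2).congr_deriv ?_
    simp only [hu', hu, hFdef, Real.sign_of_pos hx, abs_of_pos hx]
    ring
  have hdneg : ∀ x, x < 0 → HasDerivAt u (u' x) x := by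
    intro x hx
    have h1 := (hdpos (-x) (by linarith)).scomp x (hasDerivAt_neg x)
    have h2 : u ∘ Neg.neg = u := by ext y; simp [heven]
    change HasDerivAt (u ∘ Neg.neg) _ x at h1
    rw [h2] at h1
    refine h1.congr_deriv ?_
    simp only [hu', heven, Real.sign_of_neg hx, Real.sign_of_pos (show 0 < -x by linarith)]
    simp
  have hu'c : ContinuousAt u' 0 := by
    have h0 : u' 0 = 0 := by simp [hu']
    rw [ContinuousAt, h0]
    have h1 : Tendsto (fun x => u x * √(pot c q M - pot c q (u x))) (nhds 0) (nhds 0) := by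
      have : Continuous fun x => u x * √(pot c q M - pot c q (u x)) := by fun_prop
      have := this.tendsto 0
      simpa [hu0] using this
    refine squeeze_zero_norm (fun x => ?_) h1
    have hn : 0 ≤ u x * √(pot c q M - pot c q (u x)) := mul_nonneg (hupos x).le (sqrt_nonneg _)
    rw [hu', norm_mul, Real.norm_of_nonneg hn, norm_neg]
    have : ‖Real.sign x‖ ≤ 1 := by
      rcases Real.sign_apply_eq x with h | h | h <;> simp [h]
    nlinarith
  refine ⟨u, u', hu0, hupos, heven, hanti, hlt, ?_, ?_, ?_, ?_⟩
  · have h1 : Tendsto (fun x => M * exp (-z x)) atTop (nhds (M * 0)) :=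
      (Real.tendsto_exp_atBot.comp (tendsto_neg_atTop_atBot.comp hztop)).const_mul M
    rw [mul_zero] at h1
    refine h1.congr' ?_
    filter_upwards [eventually_ge_atTop 0] with x hx
    simp [hu, abs_of_nonneg hx]
  · refine hasDerivAt_of_hasDerivAt_of_ne' (x := 0) (fun y hy => ?_) huc.continuousAt hu'c
    rcases lt_or_gt_of_ne hy with h | h
    · exact hdneg y h
    · exact hdpos y h
  · intro x hx
    simp [hu', Real.sign_of_pos hx]
  · intro x
    have hnn : 0 ≤ pot c q M - pot c q (u x) := by
      have := (pot_strictMonoOn hc hq).monotoneOn (mem_Ici.2 (hupos x).le) (mem_Ici.2 hM.le)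
        (hleM x)
      linarith
    rcases eq_or_ne x 0 with h | h
    · simp [hu', h, hu0]
    · have hs : Real.sign x ^ 2 = 1 := by
        rcases Real.sign_apply_eq_of_ne_zero x h with h | h <;> simp [h]
      simp only [hu']
      rw [mul_pow, neg_sq, hs, mul_pow, Real.sq_sqrt hnn, one_mul]

/-- Half the mass of a soliton, as an integral over the normalized height `s = u / M`;
here `β = c * M ^ (q - 4)`. -/
noncomputable def profileMass (q β : ℝ) : ℝ :=
  ∫ s in (0 : ℝ)..1, s / √((1 - s ^ 4) / 3 + β * (1 - s ^ q))

lemma critical_profile_integral :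
    IntervalIntegrable (fun s : ℝ => s / √((1 - s ^ 4) / 3)) volume 0 1 ∧
      ∫ s in (0 : ℝ)..1, s / √((1 - s ^ 4) / 3) = √3 * π / 4 := by
  have hcont : ContinuousOn (fun s : ℝ => √3 / 2 * arcsin (s ^ 2)) (Icc 0 1) := by
    have := Real.continuous_arcsin
    fun_prop
  have hder : ∀ s ∈ Ioo (0 : ℝ) 1,
      HasDerivAt (fun s : ℝ => √3 / 2 * arcsin (s ^ 2)) (s / √((1 - s ^ 4) / 3)) s := by
    intro s hs
    have h1 : s ^ 2 < 1 := by nlinarith [hs.1, hs.2]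
    have h2 : HasDerivAt (fun s : ℝ => arcsin (s ^ 2)) _ s :=
      (Real.hasDerivAt_arcsin (x := s ^ 2) (by nlinarith [sq_nonneg s]) h1.ne).comp
        (h := fun s : ℝ => s ^ 2) s (hasDerivAt_pow 2 s)
    refine (h2.const_mul (√3 / 2)).congr_deriv ?_
    have h3 : 0 < 1 - s ^ 4 := by nlinarith [sq_nonneg s]
    rw [Real.sqrt_div h3.le, show (s ^ 2) ^ 2 = s ^ 4 by ring]
    have := Real.sqrt_pos.2 h3
    field_simp
    norm_num
  have hint : IntervalIntegrable (fun s : ℝ => s / √((1 - s ^ 4) / 3)) volume 0 1 := by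
    rw [intervalIntegrable_iff_integrableOn_Ioc_of_le zero_le_one]
    exact intervalIntegral.integrableOn_deriv_of_nonneg hcont hder
      fun s hs => div_nonneg hs.1.le (Real.sqrt_nonneg _)
  refine ⟨hint, ?_⟩
  rw [intervalIntegral.integral_eq_sub_of_hasDerivAt_of_le zero_le_one hcont hder hint]
  simp
  ring

lemma profile_le {q β β' s : ℝ} (hq : 0 < q) (hβ : 0 ≤ β) (hββ' : β ≤ β') (hs : s ∈ Ioc (0 : ℝ) 1) :
    s / √((1 - s ^ 4) / 3 + β' * (1 - s ^ q)) ≤ s / √((1 - s ^ 4) / 3 + β * (1 - s ^ q)) := by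
  rcases eq_or_lt_of_le hs.2 with h | h
  · simp [h]
  · have h4 : s ^ 4 < 1 := pow_lt_one₀ hs.1.le h (by norm_num)
    have h5 : s ^ q < 1 := Real.rpow_lt_one hs.1.le h hq
    have h6 : β * (1 - s ^ q) ≤ β' * (1 - s ^ q) :=
      mul_le_mul_of_nonneg_right hββ' (by linarith)
    have h7 : 0 ≤ β * (1 - s ^ q) := mul_nonneg hβ (by linarith)
    apply div_le_div_of_nonneg_left hs.1.le (Real.sqrt_pos.2 (by linarith))
    exact Real.sqrt_le_sqrt (by linarith)

lemma measurable_profile (q β : ℝ) :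
    Measurable fun s : ℝ => s / √((1 - s ^ 4) / 3 + β * (1 - s ^ q)) := by
  fun_prop

lemma norm_profile_le {q β s : ℝ} (hq : 0 < q) (hβ : 0 ≤ β) (hs : s ∈ Ioc (0 : ℝ) 1) :
    ‖s / √((1 - s ^ 4) / 3 + β * (1 - s ^ q))‖ ≤ s / √((1 - s ^ 4) / 3) := by
  rw [Real.norm_of_nonneg (div_nonneg hs.1.le (Real.sqrt_nonneg _))]
  simpa using profile_le hq le_rfl hβ hs

lemma intervalIntegrable_profile {q β : ℝ} (hq : 0 < q) (hβ : 0 ≤ β) :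
    IntervalIntegrable (fun s : ℝ => s / √((1 - s ^ 4) / 3 + β * (1 - s ^ q))) volume 0 1 := by
  refine critical_profile_integral.1.mono_fun (measurable_profile q β).aestronglyMeasurable ?_
  rw [uIoc_of_le zero_le_one]
  filter_upwards [ae_restrict_mem measurableSet_Ioc] with s hs
  exact (norm_profile_le hq hβ hs).trans (le_abs_self _)

lemma profileMass_antitoneOn {q : ℝ} (hq : 0 < q) : AntitoneOn (profileMass q) (Ici 0) := by
  intro β hβ β' hβ' h
  refine intervalIntegral.integral_mono_on_of_le_Ioo zero_le_one
    (intervalIntegrable_profile hq hβ') (intervalIntegrable_profile hq hβ) fun s hs => ?_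
  exact profile_le hq hβ h ⟨hs.1, hs.2.le⟩

lemma profileMass_zero (q : ℝ) : profileMass q 0 = √3 * π / 4 := by
  simpa [profileMass] using critical_profile_integral.2

lemma continuousOn_profileMass {q : ℝ} (hq : 0 < q) : ContinuousOn (profileMass q) (Ici 0) := by
  intro β hβ
  refine intervalIntegral.continuousWithinAt_of_dominated_interval
    (bound := fun s => s / √((1 - s ^ 4) / 3))
    (Eventually.of_forall fun β => (measurable_profile q β).aestronglyMeasurable) ?_
    critical_profile_integral.1 ?_
  · filter_upwards [self_mem_nhdsWithin] with b hb
    refine Eventually.of_forall fun s hs => ?_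
    rw [uIoc_of_le zero_le_one] at hs
    exact norm_profile_le hq hb hs
  · refine Eventually.of_forall fun s hs => ?_
    rw [uIoc_of_le zero_le_one] at hs
    rcases eq_or_lt_of_le hs.2 with h | h
    · simp only [h]
      simpa using continuousWithinAt_const
    · have h4 : s ^ 4 < 1 := pow_lt_one₀ hs.1.le h (by norm_num)
      have h5 : s ^ q < 1 := Real.rpow_lt_one hs.1.le h hq
      have h7 : 0 ≤ β * (1 - s ^ q) := mul_nonneg hβ (by linarith)
      have h8 : √((1 - s ^ 4) / 3 + β * (1 - s ^ q)) ≠ 0 := (Real.sqrt_pos.2 (by linarith)).ne'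
      apply ContinuousAt.continuousWithinAt
      refine ContinuousAt.div continuousAt_const ?_ h8
      fun_prop

lemma tendsto_profileMass_atTop {q : ℝ} (hq : 0 < q) :
    Tendsto (profileMass q) atTop (nhds 0) := by
  have h0 : (∫ _ in (0 : ℝ)..1, (0 : ℝ)) = 0 := by simp
  rw [← h0]
  refine intervalIntegral.tendsto_integral_filter_of_dominated_convergence
    (fun s => s / √((1 - s ^ 4) / 3))
    (Eventually.of_forall fun β => (measurable_profile q β).aestronglyMeasurable) ?_
    critical_profile_integral.1 ?_
  · filter_upwards [eventually_ge_atTop 0] with b hb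
    refine Eventually.of_forall fun s hs => ?_
    rw [uIoc_of_le zero_le_one] at hs
    exact norm_profile_le hq hb hs
  · refine Eventually.of_forall fun s hs => ?_
    rw [uIoc_of_le zero_le_one] at hs
    rcases eq_or_lt_of_le hs.2 with h | h
    · simp [h]
    · have h5 : s ^ q < 1 := Real.rpow_lt_one hs.1.le h hq
      refine Tendsto.const_div_atTop (Real.tendsto_sqrt_atTop.comp ?_) s
      exact tendsto_atTop_add_const_left _ _ (tendsto_id.atTop_mul_const (by linarith))

lemma exists_profileMass_eq {q μ : ℝ} (hq : 0 < q) (hμ : 0 < μ) (hμR : μ < π * √3 / 2) :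
    ∃ β, 0 < β ∧ 2 * profileMass q β = μ := by
  obtain ⟨b, hb0, hb⟩ := ((eventually_ge_atTop (0 : ℝ)).and
    ((tendsto_profileMass_atTop hq).eventually (gt_mem_nhds (half_pos hμ)))).exists
  have h0 := profileMass_zero q
  have hmem : μ / 2 ∈ Icc (profileMass q b) (profileMass q 0) := ⟨hb.le, by rw [h0]; linarith⟩
  obtain ⟨β, hβ, hβμ⟩ := intermediate_value_Icc' hb0
    ((continuousOn_profileMass hq).mono Icc_subset_Ici_self) hmem
  refine ⟨β, lt_of_le_of_ne hβ.1 ?_, by linarith⟩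
  rintro rfl
  linarith

lemma profile_scaling {c q M s : ℝ} (hM : 0 < M) (hs : 0 ≤ s) :
    M * s / √(pot c q M - pot c q (M * s)) =
      M⁻¹ * (s / √((1 - s ^ 4) / 3 + c * M ^ (q - 4) * (1 - s ^ q))) := by
  have hMq : M ^ q = M ^ 4 * M ^ (q - 4) := by
    rw [← Real.rpow_natCast, ← Real.rpow_add hM]; congr 1; push_cast; ring
  have h : pot c q M - pot c q (M * s) =
      (M ^ 2) ^ 2 * ((1 - s ^ 4) / 3 + c * M ^ (q - 4) * (1 - s ^ q)) := by
    simp only [pot, abs_of_pos hM, abs_of_nonneg (mul_nonneg hM.le hs),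
      Real.mul_rpow hM.le hs, hMq]
    ring
  rw [h, Real.sqrt_mul (by positivity), Real.sqrt_sq (by positivity)]
  rcases eq_or_ne (√((1 - s ^ 4) / 3 + c * M ^ (q - 4) * (1 - s ^ q))) 0 with h0 | h0
  · simp [h0]
  · field_simp

/-- Half the mass of the soliton of height `M`. -/
lemma soliton_mass_integral {c q M : ℝ} (hc : 0 < c) (hq : 0 < q) (hM : 0 < M) :
    IntervalIntegrable (fun t => t / √(pot c q M - pot c q t)) volume 0 M ∧
      ∫ t in (0 : ℝ)..M, t / √(pot c q M - pot c q t) = profileMass q (c * M ^ (q - 4)) := by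
  have hβ : 0 ≤ c * M ^ (q - 4) := by positivity
  have hscale : ∀ s ∈ Icc (0 : ℝ) 1, M⁻¹ * (s / √((1 - s ^ 4) / 3 + c * M ^ (q - 4) * (1 - s ^ q))) =
      M * s / √(pot c q M - pot c q (M * s)) := fun s hs => (profile_scaling hM hs.1).symm
  constructor
  · have h1 := (intervalIntegrable_profile hq hβ).const_mul M⁻¹
    have h2 : IntervalIntegrable (fun s => M * s / √(pot c q M - pot c q (M * s))) volume 0 1 := by
      refine h1.congr fun s hs => hscale s ?_
      rw [uIoc_of_le zero_le_one] at hs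
      exact ⟨hs.1.le, hs.2⟩
    have h3 := h2.comp_mul_left (c := M⁻¹)
    simpa [mul_inv_cancel_left₀ hM.ne'] using h3
  · have h1 := intervalIntegral.integral_comp_mul_left (a := 0) (b := 1)
      (fun t => t / √(pot c q M - pot c q t)) hM.ne'
    have h2 : ∫ s in (0 : ℝ)..1, M * s / √(pot c q M - pot c q (M * s)) =
        M⁻¹ * profileMass q (c * M ^ (q - 4)) := by
      rw [profileMass, ← intervalIntegral.integral_const_mul]
      refine intervalIntegral.integral_congr fun s hs => (hscale s ?_).symm
      rwa [uIcc_of_le zero_le_one] at hs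
    rw [h2] at h1
    simp only [mul_zero, mul_one, smul_eq_mul] at h1
    exact (mul_left_cancel₀ (inv_ne_zero hM.ne') h1).symm

/-- Half the minimal value of `∫ (½ u'² + ½ u² (pot M - pot u))` among profiles of height `M`. -/
noncomputable def solitonAction (c q M : ℝ) : ℝ :=
  ∫ t in (0 : ℝ)..M, t * √(pot c q M - pot c q t)

lemma ofReal_intervalIntegral {f : ℝ → ℝ} {a b : ℝ} (hab : a ≤ b)
    (hf : IntervalIntegrable f volume a b) (hpos : ∀ x ∈ Ioo a b, 0 ≤ f x) :
    ENNReal.ofReal (∫ x in a..b, f x) = ∫⁻ x in Ioo a b, ENNReal.ofReal (f x) := by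
  rw [intervalIntegral.integral_of_le hab, integral_Ioc_eq_integral_Ioo]
  rw [intervalIntegrable_iff_integrableOn_Ioo_of_le hab] at hf
  refine ofReal_integral_eq_lintegral_ofReal hf ?_
  filter_upwards [ae_restrict_mem measurableSet_Ioo] with x hx using hpos x hx

lemma ofReal_solitonAction {c q M : ℝ} (hc : 0 < c) (hq : 0 < q) (hM : 0 < M) :
    ENNReal.ofReal (solitonAction c q M) =
      ∫⁻ r in Ioo 0 M, ENNReal.ofReal (pot' c q r / 2 * profileMass q (c * r ^ (q - 4))) := by
  have hpc := continuous_pot c hq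
  have hm := pot_strictMonoOn hc hq
  have hm' : ∀ {s t}, 0 < s → s < t → 0 < pot c q t - pot c q s := fun hs hst =>
    sub_pos.2 (hm (mem_Ici.2 hs.le) (mem_Ici.2 (hs.trans hst).le) hst)
  have hI : IntervalIntegrable (fun t => t * √(pot c q M - pot c q t)) volume 0 M :=
    Continuous.intervalIntegrable (by fun_prop) _ _
  rw [solitonAction, ofReal_intervalIntegral hM.le hI
    fun t ht => mul_nonneg ht.1.le (Real.sqrt_nonneg _)]
  set f : ℝ → ℝ → ENNReal := fun t r =>
    ENNReal.ofReal (pot' c q r / 2 * (t / √(pot c q r - pot c q t))) with hf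
  have hfm : Measurable (Function.uncurry f) := by
    have := measurable_pot' c q
    have := hpc.measurable
    apply ENNReal.measurable_ofReal.comp
    fun_prop
  have hinner : ∀ t ∈ Ioo 0 M, ENNReal.ofReal (t * √(pot c q M - pot c q t)) =
      ∫⁻ r in Ioo 0 M, if t < r then f t r else 0 := by
    intro t ht
    have hcont : ContinuousOn (fun r => t * √(pot c q r - pot c q t)) (Icc t M) := by fun_prop
    have hder : ∀ r ∈ Ioo t M, HasDerivAt (fun r => t * √(pot c q r - pot c q t))
        (pot' c q r / 2 * (t / √(pot c q r - pot c q t))) r := by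
      intro r hr
      have h1 := (((hasDerivAt_pot c q (ht.1.trans hr.1)).sub_const (pot c q t)).sqrt
        (hm' ht.1 hr.1).ne').const_mul t
      refine h1.congr_deriv ?_
      have := Real.sqrt_pos.2 (hm' ht.1 hr.1)
      field_simp
    have hpos : ∀ r ∈ Ioo t M, 0 ≤ pot' c q r / 2 * (t / √(pot c q r - pot c q t)) := by
      intro r hr
      have := pot'_pos hc hq (ht.1.trans hr.1)
      have := ht.1
      positivity
    have hint : IntervalIntegrable (fun r => pot' c q r / 2 * (t / √(pot c q r - pot c q t)))
        volume t M := by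
      rw [intervalIntegrable_iff_integrableOn_Ioc_of_le ht.2.le]
      exact intervalIntegral.integrableOn_deriv_of_nonneg hcont hder hpos
    have h2 := intervalIntegral.integral_eq_sub_of_hasDerivAt_of_le ht.2.le hcont hder hint
    have h3 : t * √(pot c q M - pot c q t) =
        ∫ r in t..M, pot' c q r / 2 * (t / √(pot c q r - pot c q t)) := by
      rw [h2]; simp
    rw [h3, ofReal_intervalIntegral ht.2.le hint hpos]
    change _ = ∫⁻ r in Ioo 0 M, (Ioi t).indicator (f t) r
    rw [setLIntegral_indicator measurableSet_Ioi]
    congr 2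
    ext r
    simp only [mem_inter_iff, mem_Ioi, mem_Ioo]
    exact ⟨fun h => ⟨h.1, ht.1.trans h.1, h.2⟩, fun h => ⟨h.1, h.2.2⟩⟩
  have houter : ∀ r ∈ Ioo 0 M, ∫⁻ t in Ioo 0 M, (if t < r then f t r else 0) =
      ENNReal.ofReal (pot' c q r / 2 * profileMass q (c * r ^ (q - 4))) := by
    intro r hr
    obtain ⟨h1, h2⟩ := soliton_mass_integral hc hq hr.1
    have hpos : ∀ t ∈ Ioo 0 r, 0 ≤ pot' c q r / 2 * (t / √(pot c q r - pot c q t)) := by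
      intro t ht
      have := pot'_pos hc hq hr.1
      have := ht.1
      positivity
    rw [← h2, ← intervalIntegral.integral_const_mul,
      ofReal_intervalIntegral hr.1.le (h1.const_mul _) hpos]
    change ∫⁻ t in Ioo 0 M, (Iio r).indicator (fun t => f t r) t = _
    rw [setLIntegral_indicator measurableSet_Iio]
    congr 2
    ext t
    simp only [mem_inter_iff, mem_Iio, mem_Ioo]
    exact ⟨fun h => ⟨h.2.1, h.1⟩, fun h => ⟨h.2, h.1, h.2.trans hr.2⟩⟩
  rw [setLIntegral_congr_fun measurableSet_Ioo hinner, lintegral_lintegral_swap,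
    setLIntegral_congr_fun measurableSet_Ioo houter]
  refine Measurable.aemeasurable ?_
  exact Measurable.ite (measurableSet_lt measurable_fst measurable_snd) hfm measurable_const

lemma ofReal_solitonAction_add {c q a b : ℝ} (hc : 0 < c) (hq : 0 < q) (ha : 0 < a) (hab : a ≤ b) :
    ENNReal.ofReal (solitonAction c q b) = ENNReal.ofReal (solitonAction c q a) +
      ∫⁻ r in Ioo a b, ENNReal.ofReal (pot' c q r / 2 * profileMass q (c * r ^ (q - 4))) := by
  rw [ofReal_solitonAction hc hq ha, ofReal_solitonAction hc hq (ha.trans_le hab),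
    ← Ioo_union_Ico_eq_Ioo ha hab, lintegral_union measurableSet_Ico,
    setLIntegral_congr (Ioo_ae_eq_Ico (a := a) (b := b)).symm]
  rw [Set.disjoint_left]
  intro x hx hx'
  exact absurd hx.2 (not_lt.2 hx'.1)

lemma lintegral_pot'_mul_const {c q a b C : ℝ} (hc : 0 < c) (hq : 0 < q) (ha : 0 < a) (hab : a ≤ b)
    (hC : 0 ≤ C) :
    ∫⁻ r in Ioo a b, ENNReal.ofReal (pot' c q r / 2 * C) =
      ENNReal.ofReal ((pot c q b - pot c q a) / 2 * C) := by
  have hpos : ∀ r ∈ Ioo a b, 0 ≤ pot' c q r / 2 * C := by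
    intro r hr
    have := pot'_pos hc hq (ha.trans hr.1)
    positivity
  have hcont : ContinuousOn (fun r => pot c q r / 2 * C) (Icc a b) := by
    have := continuous_pot c hq
    fun_prop
  have hder : ∀ r ∈ Ioo a b, HasDerivAt (fun r => pot c q r / 2 * C) (pot' c q r / 2 * C) r :=
    fun r hr => ((hasDerivAt_pot c q (ha.trans hr.1)).div_const 2).mul_const C
  have hint : IntervalIntegrable (fun r => pot' c q r / 2 * C) volume a b := by
    rw [intervalIntegrable_iff_integrableOn_Ioc_of_le hab]
    exact intervalIntegral.integrableOn_deriv_of_nonneg hcont hder hpos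
  rw [← ofReal_intervalIntegral hab hint hpos,
    intervalIntegral.integral_eq_sub_of_hasDerivAt_of_le hab hcont hder hint]
  congr 1
  ring

lemma solitonAction_nonneg {c q M : ℝ} (hM : 0 ≤ M) : 0 ≤ solitonAction c q M :=
  intervalIntegral.integral_nonneg hM fun _ ht => mul_nonneg ht.1 (Real.sqrt_nonneg _)

lemma profileMass_nonneg (q β : ℝ) : 0 ≤ profileMass q β :=
  intervalIntegral.integral_nonneg zero_le_one fun _ ht => div_nonneg ht.1 (Real.sqrt_nonneg _)

/-- The function `M ↦ 2 * solitonAction c q M - pot c q M * μ / 2` is minimal at the height of the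
soliton of mass `μ`. -/
lemma solitonAction_minimal {c q a M : ℝ} (hc : 0 < c) (hq : 0 < q) (hq4 : q < 4)
    (ha : 0 < a) (hM : 0 < M) :
    solitonAction c q M - pot c q M / 2 * profileMass q (c * M ^ (q - 4)) ≤
      solitonAction c q a - pot c q a / 2 * profileMass q (c * M ^ (q - 4)) := by
  set m := profileMass q (c * M ^ (q - 4)) with hm
  have hm0 : 0 ≤ m := profileMass_nonneg _ _
  have hmono : ∀ r s, 0 < r → r ≤ s →
      profileMass q (c * r ^ (q - 4)) ≤ profileMass q (c * s ^ (q - 4)) := by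
    intro r s hr hrs
    have hs := hr.trans_le hrs
    refine profileMass_antitoneOn hq (mem_Ici.2 (by positivity)) (mem_Ici.2 (by positivity)) ?_
    exact mul_le_mul_of_nonneg_left (Real.rpow_le_rpow_of_nonpos hr hrs (by linarith)) hc.le
  have hpm := (pot_strictMonoOn hc hq).monotoneOn
  rcases le_total a M with h | h
  · have hpos : 0 ≤ (pot c q M - pot c q a) / 2 * m :=
      mul_nonneg (by linarith [hpm (mem_Ici.2 ha.le) (mem_Ici.2 hM.le) h]) hm0
    have h1 := ofReal_solitonAction_add hc hq ha h
    have h2 : ENNReal.ofReal (solitonAction c q M) ≤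
        ENNReal.ofReal (solitonAction c q a + (pot c q M - pot c q a) / 2 * m) := by
      rw [h1, ENNReal.ofReal_add (solitonAction_nonneg ha.le) hpos,
        ← lintegral_pot'_mul_const hc hq ha h hm0]
      gcongr 1
      refine setLIntegral_mono' measurableSet_Ioo fun r hr => ENNReal.ofReal_le_ofReal ?_
      have := pot'_pos hc hq (ha.trans hr.1)
      exact mul_le_mul_of_nonneg_left (hmono r M (ha.trans hr.1) hr.2.le) (by positivity)
    have h3 := (ENNReal.ofReal_le_ofReal_iff
      (add_nonneg (solitonAction_nonneg ha.le) hpos)).1 h2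
    linarith
  · have hpos : 0 ≤ (pot c q a - pot c q M) / 2 * m :=
      mul_nonneg (by linarith [hpm (mem_Ici.2 hM.le) (mem_Ici.2 ha.le) h]) hm0
    have h1 := ofReal_solitonAction_add hc hq hM h
    have h2 : ENNReal.ofReal (solitonAction c q M + (pot c q a - pot c q M) / 2 * m) ≤
        ENNReal.ofReal (solitonAction c q a) := by
      rw [h1, ENNReal.ofReal_add (solitonAction_nonneg hM.le) hpos,
        ← lintegral_pot'_mul_const hc hq hM h hm0]
      gcongr 1
      refine setLIntegral_mono' measurableSet_Ioo fun r hr => ENNReal.ofReal_le_ofReal ?_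
      have := pot'_pos hc hq (hM.trans hr.1)
      exact mul_le_mul_of_nonneg_left (hmono M r hM hr.1.le) (by positivity)
    have h3 := (ENNReal.ofReal_le_ofReal_iff (solitonAction_nonneg ha.le)).1 h2
    linarith

lemma integral_eq_two_mul_of_even {f : ℝ → ℝ} (heven : ∀ x, f (-x) = f x)
    (hf : IntegrableOn f (Ioi 0)) : Integrable f ∧ ∫ x, f x = 2 * ∫ x in Ioi 0, f x := by
  have habs : (fun x => f |x|) = f := by
    ext x
    rcases abs_choice x with h | h <;> simp [h, heven]
  constructor
  · rw [← integrableOn_univ, ← Iic_union_Ioi (a := (0 : ℝ)), integrableOn_union]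
    refine ⟨?_, hf⟩
    rw [integrableOn_Iic_iff_integrableOn_Iio]
    have := IntegrableOn.comp_neg_Iio (c := 0) (f := f) (by simpa using hf)
    simpa [heven] using this
  · rw [← integral_comp_abs, habs]

/-- Change of variables along a decreasing solution of `u' = -a`. -/
lemma integral_comp_decreasing {w u a : ℝ → ℝ} {M : ℝ} (hM : 0 < M)
    (hwc : ContinuousOn w (Ioo 0 M)) (hw0 : ∀ t ∈ Ioo 0 M, 0 ≤ w t)
    (hw : IntervalIntegrable w volume 0 M) (hu : Continuous u) (hu0 : u 0 = M)
    (hmem : ∀ x, 0 < x → u x ∈ Ioo 0 M) (hlim : Tendsto u atTop (nhds 0))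
    (hd : ∀ x, 0 < x → HasDerivAt u (-a x) x) (ha : ∀ x, 0 < x → 0 ≤ a x) :
    IntegrableOn (fun x => w (u x) * a x) (Ioi 0) ∧
      ∫ x in Ioi 0, w (u x) * a x = ∫ t in (0 : ℝ)..M, w t := by
  set Θ : ℝ → ℝ := fun t => ∫ s in (0 : ℝ)..t, w s with hΘ
  have hmem' : ∀ x, 0 ≤ x → u x ∈ Icc 0 M := by
    intro x hx
    rcases hx.eq_or_lt with h | h
    · rw [← h, hu0]; exact ⟨hM.le, le_rfl⟩
    · exact Ioo_subset_Icc_self (hmem x h)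
  have hΘc : ContinuousOn Θ (Icc 0 M) := by
    have := intervalIntegral.continuousOn_primitive_interval (μ := volume) (f := w) (a := 0) (b := M)
      (by rw [uIcc_of_le hM.le]; exact (intervalIntegrable_iff_integrableOn_Icc_of_le hM.le).1 hw)
    rwa [uIcc_of_le hM.le] at this
  have hcont : ContinuousWithinAt (fun x => -Θ (u x)) (Ici 0) 0 := by
    refine ContinuousWithinAt.neg ?_
    refine ContinuousWithinAt.comp (t := Icc 0 M) (hΘc _ (hmem' 0 le_rfl)) hu.continuousWithinAt ?_
    exact fun x hx => hmem' x hx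
  have hder : ∀ x ∈ Ioi (0 : ℝ), HasDerivAt (fun x => -Θ (u x)) (w (u x) * a x) x := by
    intro x hx
    have hx' := hmem x hx
    have hsm : StronglyMeasurableAtFilter w (nhds (u x)) volume :=
      hwc.stronglyMeasurableAtFilter isOpen_Ioo (u x) hx'
    have h1 : HasDerivAt Θ (w (u x)) (u x) :=
      intervalIntegral.integral_hasDerivAt_right
        (hw.mono_set (by
          rw [uIcc_of_le hx'.1.le, uIcc_of_le hM.le]; exact Icc_subset_Icc_right hx'.2.le))
        hsm (hwc.continuousAt (isOpen_Ioo.mem_nhds hx'))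
    refine (h1.comp x (hd x hx)).neg.congr_deriv ?_
    ring
  have hlimΘ : Tendsto (fun x => -Θ (u x)) atTop (nhds 0) := by
    have h0 : Θ 0 = 0 := by simp [hΘ]
    have h1 : Tendsto Θ (nhdsWithin 0 (Icc 0 M)) (nhds 0) := by
      have := hΘc 0 ⟨le_rfl, hM.le⟩
      rwa [ContinuousWithinAt, h0] at this
    have h2 : Tendsto u atTop (nhdsWithin 0 (Icc 0 M)) := by
      refine tendsto_nhdsWithin_iff.2 ⟨hlim, ?_⟩
      filter_upwards [eventually_ge_atTop 0] with x hx using hmem' x hx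
    simpa using (h1.comp h2).neg
  have hpos : ∀ x ∈ Ioi (0 : ℝ), 0 ≤ w (u x) * a x :=
    fun x hx => mul_nonneg (hw0 _ (hmem x hx)) (ha x hx)
  refine ⟨integrableOn_Ioi_deriv_of_nonneg hcont hder hpos hlimΘ, ?_⟩
  rw [integral_Ioi_of_hasDerivAt_of_nonneg hcont hder hpos hlimΘ, hu0]
  simp [hΘ]

lemma energy_density {p : ℝ} (hp : 2 < p) (α t : ℝ) :
    1 / 6 * |t| ^ 6 + α / p * |t| ^ p = t ^ 2 / 2 * pot (2 * α / p) (p - 2) t := by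
  have h6 : |t| ^ 6 = t ^ 6 := by
    rw [show (6 : ℕ) = 2 * 3 from rfl, pow_mul, sq_abs, ← pow_mul]
  have h2 : |t| ^ p = t ^ 2 * |t| ^ (p - 2) := by
    rw [← sq_abs t, ← Real.rpow_natCast, ← Real.rpow_add_of_nonneg (abs_nonneg t) (by simp)
      (by linarith)]
    congr 1; push_cast; ring
  rw [pot, h6, h2]
  ring

lemma exists_soliton_energy {p α M : ℝ} (hp : 2 < p) (hα : 0 < α) (hM : 0 < M) :
    ∃ u u' : ℝ → ℝ, H1line u u' ∧
      ∫ x, u x ^ 2 = 2 * profileMass (p - 2) (2 * α / p * M ^ (p - 2 - 4)) ∧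
      Eline p α u u' = 2 * solitonAction (2 * α / p) (p - 2) M -
        pot (2 * α / p) (p - 2) M / 2 * ∫ x, u x ^ 2 ∧
      (∀ x, 0 < u x) ∧ (∀ x, u (-x) = u x) ∧ AntitoneOn u (Ici 0) := by
  have hc : 0 < 2 * α / p := by positivity
  have hq : 0 < p - 2 := by linarith
  set c := 2 * α / p
  set q := p - 2
  obtain ⟨u, u', hu0, hupos, heven, hanti, hlt, hlim, hd, hu', hsq⟩ := exists_soliton hc hq hM
  have hpc := continuous_pot c hq
  have huc : Continuous u := continuous_iff_continuousAt.2 fun x => (hd x).continuousAt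
  have hmem : ∀ x, 0 < x → u x ∈ Ioo 0 M := fun x hx => ⟨hupos x, hlt x hx⟩
  have hgap : ∀ t ∈ Ioo 0 M, 0 < pot c q M - pot c q t := fun t ht =>
    sub_pos.2 (pot_strictMonoOn hc hq (mem_Ici.2 ht.1.le) (mem_Ici.2 hM.le) ht.2)
  have hd' : ∀ x, 0 < x → HasDerivAt u (-(u x * √(pot c q M - pot c q (u x)))) x :=
    fun x hx => hu' x hx ▸ hd x
  have ha : ∀ x, 0 < x → 0 ≤ u x * √(pot c q M - pot c q (u x)) :=
    fun x _ => mul_nonneg (hupos x).le (Real.sqrt_nonneg _)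
  obtain ⟨hmI, hmeq⟩ := soliton_mass_integral hc hq hM
  have hmass := integral_comp_decreasing (w := fun t => t / √(pot c q M - pot c q t)) hM
    (ContinuousOn.div continuousOn_id (by fun_prop)
      fun t ht => (Real.sqrt_pos.2 (hgap t ht)).ne')
    (fun t ht => div_nonneg ht.1.le (Real.sqrt_nonneg _)) hmI huc hu0 hmem hlim hd' ha
  have hact := integral_comp_decreasing (w := fun t => t * √(pot c q M - pot c q t)) hM
    (by fun_prop) (fun t ht => mul_nonneg ht.1.le (Real.sqrt_nonneg _))
    (Continuous.intervalIntegrable (by fun_prop) _ _) huc hu0 hmem hlim hd' ha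
  have hmass_eq : EqOn (fun x => u x / √(pot c q M - pot c q (u x)) *
      (u x * √(pot c q M - pot c q (u x)))) (fun x => u x ^ 2) (Ioi 0) := by
    intro x hx
    have := Real.sqrt_pos.2 (hgap _ (hmem x hx))
    simp only
    field_simp
  have hact_eq : EqOn (fun x => u x * √(pot c q M - pot c q (u x)) *
      (u x * √(pot c q M - pot c q (u x)))) (fun x => u' x ^ 2) (Ioi 0) := by
    intro x hx
    simp only
    rw [hu' x hx]; ring
  rw [integrableOn_congr_fun hmass_eq measurableSet_Ioi,
    setIntegral_congr_fun measurableSet_Ioi hmass_eq, hmeq] at hmass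
  rw [integrableOn_congr_fun hact_eq measurableSet_Ioi,
    setIntegral_congr_fun measurableSet_Ioi hact_eq] at hact
  obtain ⟨hI1, hE1⟩ := integral_eq_two_mul_of_even (f := fun x => u x ^ 2)
    (fun x => by simp only [heven]) hmass.1
  obtain ⟨hI2, hE2⟩ := integral_eq_two_mul_of_even (f := fun x => u' x ^ 2)
    (fun x => by simp only [hsq, heven]) hact.1
  rw [hmass.2] at hE1
  rw [hact.2] at hE2
  refine ⟨u, u', ⟨hd, hI1, hI2⟩, hE1, ?_, hupos, heven, hanti⟩
  have hdens : ∀ x, 1 / 2 * (u' x) ^ 2 - 1 / 6 * |u x| ^ 6 - α / p * |u x| ^ p =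
      u' x ^ 2 - pot c q M / 2 * u x ^ 2 := by
    intro x
    have h1 := energy_density hp α (u x)
    have h2 := hsq x
    change _ = u x ^ 2 / 2 * pot c q (u x) at h1
    linarith
  rw [Eline, integral_congr_ae (Eventually.of_forall hdens), integral_sub hI2 (hI1.const_mul _),
    integral_const_mul, hE2]
  rfl

lemma H1line.tendsto_zero {v v' : ℝ → ℝ} (h : H1line v v') :
    Tendsto v atTop (nhds 0) ∧ Tendsto v atBot (nhds 0) := by
  obtain ⟨hd, hv, hv'⟩ := h
  have hvc : Continuous v := continuous_iff_continuousAt.2 fun x => (hd x).continuousAt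
  have hv'm : Measurable v' := by
    rw [show v' = deriv v from funext fun x => (hd x).deriv.symm]
    exact measurable_deriv v
  have hprod : Integrable fun x => 2 * v x * v' x := by
    refine (hv.add hv').mono' (by fun_prop) (Eventually.of_forall fun x => ?_)
    rw [Real.norm_eq_abs, abs_le]
    simp only [Pi.add_apply]
    constructor <;> nlinarith [sq_nonneg (v x - v' x), sq_nonneg (v x + v' x)]
  have hder : ∀ x, HasDerivAt (fun x => v x ^ 2) (2 * v x * v' x) x := fun x => by
    simpa [Pi.pow_def] using (hd x).pow 2
  have habs : ∀ {l : Filter ℝ}, Tendsto (fun x => v x ^ 2) l (nhds 0) → Tendsto v l (nhds 0) := by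
    intro l hl
    have := (Real.continuous_sqrt.tendsto 0).comp hl
    simp only [Function.comp_def, Real.sqrt_sq_eq_abs, Real.sqrt_zero] at this
    exact (tendsto_zero_iff_abs_tendsto_zero v).2 this
  exact ⟨habs (tendsto_zero_of_hasDerivAt_of_integrableOn_Ioi (a := 0) (fun x _ => hder x)
      hprod.integrableOn hv.integrableOn),
    habs (tendsto_zero_of_hasDerivAt_of_integrableOn_Iic (a := 0) (fun x _ => hder x)
      hprod.integrableOn hv.integrableOn)⟩

lemma H1line.exists_max {v v' : ℝ → ℝ} (h : H1line v v') (hpos : 0 < ∫ x, v x ^ 2) :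
    ∃ x₀, 0 < |v x₀| ∧ ∀ x, |v x| ≤ |v x₀| := by
  have hvc : Continuous v := continuous_iff_continuousAt.2 fun x => (h.1 x).continuousAt
  obtain ⟨x₁, hx₁⟩ : ∃ x, v x ≠ 0 := by
    by_contra! hv
    simp [hv] at hpos
  have h1 : 0 < |v x₁| := abs_pos.2 hx₁
  have hlim : Tendsto (fun x => |v x|) (cocompact ℝ) (nhds 0) := by
    rw [cocompact_eq_atBot_atTop]
    exact (tendsto_zero_iff_abs_tendsto_zero v).1 (tendsto_sup.2 ⟨h.tendsto_zero.2, h.tendsto_zero.1⟩)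
  obtain ⟨x₀, hx₀⟩ := hvc.abs.exists_forall_ge' x₁
    ((hlim.eventually (gt_mem_nhds h1)).mono fun x hx => hx.le)
  exact ⟨x₀, h1.trans_le (hx₀ x₁), hx₀⟩

/-- The calibration bound: the energy is controlled from below by the height and the mass. -/
lemma energy_lower_bound {p α : ℝ} (hp : 2 < p) (hα : 0 < α) {v v' : ℝ → ℝ} (h : H1line v v')
    (hpos : 0 < ∫ x, v x ^ 2) :
    ∃ M, 0 < M ∧ 2 * solitonAction (2 * α / p) (p - 2) M -
      pot (2 * α / p) (p - 2) M / 2 * ∫ x, v x ^ 2 ≤ Eline p α v v' := by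
  have hc : 0 < 2 * α / p := by positivity
  have hq : 0 < p - 2 := by linarith
  set c := 2 * α / p
  set q := p - 2
  obtain ⟨x₀, hM, hmax⟩ := h.exists_max hpos
  set M := |v x₀| with hMdef
  refine ⟨M, hM, ?_⟩
  obtain ⟨hlim₁, hlim₂⟩ := h.tendsto_zero
  obtain ⟨hd, hv, hv'⟩ := h
  have hpc := continuous_pot c hq
  have hvc : Continuous v := continuous_iff_continuousAt.2 fun x => (hd x).continuousAt
  have hv'm : Measurable v' := by
    rw [show v' = deriv v from funext fun x => (hd x).deriv.symm]
    exact measurable_deriv v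
  have hgap : ∀ x, 0 ≤ pot c q M - pot c q (v x) := by
    intro x
    rw [← pot_abs c q (v x)]
    exact sub_nonneg.2 ((pot_strictMonoOn hc hq).monotoneOn (mem_Ici.2 (abs_nonneg _))
      (mem_Ici.2 hM.le) (hmax x))
  set G : ℝ → ℝ := fun x => 1 / 2 * v' x ^ 2 + v x ^ 2 / 2 * (pot c q M - pot c q (v x)) with hG
  have hGint : Integrable G := by
    refine (hv'.const_mul (1 / 2)).add ((hv.const_mul (pot c q M / 2)).mono' (by fun_prop) ?_)
    refine Eventually.of_forall fun x => ?_
    rw [Real.norm_of_nonneg (mul_nonneg (by positivity) (hgap x))]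
    nlinarith [mul_nonneg (sq_nonneg (v x)) (pot_nonneg (q := q) hc (v x))]
  set k : ℝ → ℝ := fun s => |s| * √(pot c q M - pot c q s) with hk
  have hkc : Continuous k := by fun_prop
  set K : ℝ → ℝ := fun t => ∫ s in (0 : ℝ)..t, k s with hK
  have hKd : ∀ t, HasDerivAt K (k t) t := fun t =>
    intervalIntegral.integral_hasDerivAt_right (hkc.intervalIntegrable _ _)
      (hkc.stronglyMeasurableAtFilter _ _) hkc.continuousAt
  have hK0 : K 0 = 0 := by simp [hK]
  have hKM : |K (v x₀)| = solitonAction c q M := by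
    have h1 : K M = solitonAction c q M := by
      refine intervalIntegral.integral_congr fun t ht => ?_
      rw [uIcc_of_le hM.le] at ht
      simp [hk, abs_of_nonneg ht.1]
    have hodd : ∀ t, K (-t) = -K t := by
      intro t
      have h2 := intervalIntegral.integral_comp_neg (a := 0) (b := t) k
      have h3 : (fun s => k (-s)) = k := by
        ext s
        simp only [hk, abs_neg]
        rw [← pot_abs c q (-s), abs_neg, pot_abs c q s]
      simp only [h3, neg_zero] at h2
      simp only [hK]
      rw [h2, intervalIntegral.integral_symm]
    have h4 : 0 ≤ K M := h1 ▸ solitonAction_nonneg hM.le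
    rw [← h1]
    rcases abs_choice (v x₀) with h | h
    · rw [hMdef, h, ← h, ← hMdef, abs_of_nonneg h4]
    · rw [show v x₀ = -M by rw [hMdef, h, neg_neg], hodd, abs_neg, abs_of_nonneg h4]
  have hKvd : ∀ x, HasDerivAt (fun x => K (v x)) (k (v x) * v' x) x :=
    fun x => (hKd (v x)).comp x (hd x)
  have hle : ∀ x, ‖k (v x) * v' x‖ ≤ G x := by
    intro x
    have h1 : 0 ≤ k (v x) := mul_nonneg (abs_nonneg _) (Real.sqrt_nonneg _)
    have h2 : k (v x) ^ 2 = v x ^ 2 * (pot c q M - pot c q (v x)) := by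
      simp only [hk]
      rw [mul_pow, sq_abs, Real.sq_sqrt (hgap x)]
    rw [norm_mul, Real.norm_of_nonneg h1, Real.norm_eq_abs]
    simp only [hG]
    nlinarith [sq_nonneg (k (v x) - |v' x|), sq_abs (v' x)]
  have hKvint : Integrable fun x => k (v x) * v' x :=
    hGint.mono' (by fun_prop) (Eventually.of_forall hle)
  have hKvc : Continuous fun x => K (v x) :=
    continuous_iff_continuousAt.2 fun x => (hKvd x).continuousAt
  have hKlim : ∀ {l : Filter ℝ}, Tendsto v l (nhds 0) → Tendsto (fun x => K (v x)) l (nhds 0) := by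
    intro l hl
    have := (hKd 0).continuousAt.tendsto.comp hl
    rwa [hK0] at this
  have hright : solitonAction c q M ≤ ∫ x in Ioi x₀, G x := by
    have h1 := integral_Ioi_of_hasDerivAt_of_tendsto (a := x₀) hKvc.continuousWithinAt
      (fun x _ => hKvd x) hKvint.integrableOn (hKlim hlim₁)
    rw [← hKM, ← abs_neg, ← zero_sub, ← h1]
    exact norm_integral_le_of_norm_le hGint.integrableOn (Eventually.of_forall hle)
  have hleft : solitonAction c q M ≤ ∫ x in Iic x₀, G x := by
    have h1 := integral_Iic_of_hasDerivAt_of_tendsto (a := x₀) hKvc.continuousWithinAt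
      (fun x _ => hKvd x) hKvint.integrableOn (hKlim hlim₂)
    rw [← hKM, ← sub_zero (K (v x₀)), ← h1]
    exact norm_integral_le_of_norm_le hGint.integrableOn (Eventually.of_forall hle)
  have hsum := intervalIntegral.integral_Iic_add_Ioi (b := x₀) hGint.integrableOn hGint.integrableOn
  have hdens : ∀ x, 1 / 2 * (v' x) ^ 2 - 1 / 6 * |v x| ^ 6 - α / p * |v x| ^ p =
      G x - pot c q M / 2 * v x ^ 2 := by
    intro x
    have h1 := energy_density hp α (v x)
    change _ = v x ^ 2 / 2 * pot c q (v x) at h1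
    simp only [hG]
    linarith
  rw [Eline, integral_congr_ae (Eventually.of_forall hdens), integral_sub hGint (hv.const_mul _),
    integral_const_mul]
  linarith

/-- Focusing case on the line, existence and shape of ground states:
for `p ∈ (2,6)`, `α > 0` and `μ ∈ (0, μ_ℝ)`, the infimum `ℰ_α(μ, ℝ)` is achieved
by a strictly positive, even function which is nonincreasing on `[0, ∞)`. -/
theorem focusing_ground_state_exists_line (p α μ : ℝ)
    (hp : 2 < p) (hp' : p < 6) (hα : 0 < α)
    (hμ : 0 < μ) (hμR : μ < Real.pi * Real.sqrt 3 / 2) :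
    ∃ u u' : ℝ → ℝ, H1line u u' ∧ (∫ x, (u x) ^ 2) = μ ∧
      Eline p α u u' = glevelLine p α μ ∧
      (∀ v v' : ℝ → ℝ, H1line v v' → (∫ x, (v x) ^ 2) = μ →
        Eline p α u u' ≤ Eline p α v v') ∧
      (∀ x, 0 < u x) ∧ (∀ x, u (-x) = u x) ∧ AntitoneOn u (Set.Ici 0) := by
  have hc : 0 < 2 * α / p := by positivity
  have hq : 0 < p - 2 := by linarith
  obtain ⟨β, hβ, hβμ⟩ := exists_profileMass_eq hq hμ hμR
  obtain ⟨M, hM, hMβ⟩ : ∃ M : ℝ, 0 < M ∧ 2 * α / p * M ^ (p - 2 - 4) = β := by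
    refine ⟨(β / (2 * α / p)) ^ (p - 2 - 4)⁻¹, by positivity, ?_⟩
    rw [← Real.rpow_mul (by positivity), inv_mul_cancel₀ (by linarith), Real.rpow_one]
    field_simp
  obtain ⟨u, u', hu, hmass, henergy, hpos, heven, hanti⟩ := exists_soliton_energy hp hα hM
  rw [hMβ, hβμ] at hmass
  have hmin : ∀ v v' : ℝ → ℝ, H1line v v' → (∫ x, (v x) ^ 2) = μ →
      Eline p α u u' ≤ Eline p α v v' := by
    intro v v' hv hvμ
    obtain ⟨a, ha, hle⟩ := energy_lower_bound hp hα hv (hvμ ▸ hμ)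
    have h := solitonAction_minimal hc hq (by linarith) ha hM
    rw [hMβ] at h
    rw [hvμ, ← hβμ] at hle
    rw [henergy, hmass, ← hβμ]
    linarith
  refine ⟨u, u', hu, hmass, ?_, hmin, hpos, heven, hanti⟩
  refine Eq.symm (IsLeast.csInf_eq ?_)
  refine ⟨⟨u, u', hu, hmass, rfl⟩, ?_⟩
  rintro e ⟨v, v', hv, hvμ, rfl⟩
  exact hmin v v' hv hvμ
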